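/- Under the standing hypotheses (a seven-term arithmetic progression a, a+d, ..., a+6d in S with d ≥ 1 and 3^9 ≤ a+6d), the common difference d is even. -/

import Mathlib

/-- An even number of the form `3 ^ x + 2 ^ y` has `y = 0`. -/
theorem eq_three_pow_add_one_of_even {t x y : ℕ} (ht : 2 ∣ t) (h : t = 3 ^ x + 2 ^ y) :
    t = 3 ^ x + 1 := by
  obtain rfl | hy := Nat.eq_zero_or_pos y
  · simpa using h
  · have h3 : 3 ^ x % 2 = 1 := by simp [Nat.pow_mod]
    have h2 : 2 ∣ 2 ^ y := dvd_pow_self 2 hy.ne'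
    omega

/-- Powers of `3` form no nonconstant arithmetic progression of length three. -/
theorem three_pow_add_three_pow_ne {u v w : ℕ} (hvw : v < w) :
    3 ^ u + 3 ^ w ≠ 2 * 3 ^ v := by
  have hle : 3 ^ (v + 1) ≤ 3 ^ w := Nat.pow_le_pow_right (by norm_num) hvw
  have hpos : 0 < 3 ^ u := by positivity
  rw [pow_succ] at hle
  omega

/-- Under the standing hypotheses, the common difference d is even. -/
theorem d_even (a d m n : ℕ)
    (ha : 0 < a) (hd : 0 < d)
    (hAP : ∀ i : ℕ, i ≤ 6 → ∃ x y : ℕ, a + i * d = 3 ^ x + 2 ^ y)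
    (hbig : 3 ^ 9 ≤ a + 6 * d)
    (hm₁ : 3 ^ m ≤ a + 6 * d) (hm₂ : a + 6 * d < 3 ^ (m + 1))
    (hn₁ : 2 ^ n ≤ a + 6 * d) (hn₂ : a + 6 * d < 2 ^ (n + 1)) :
    2 ∣ d := by
  by_contra hodd
  obtain ⟨j, hj, heven⟩ : ∃ j ≤ 1, 2 ∣ a + j * d := by
    obtain h | h := Nat.mod_two_eq_zero_or_one a
    · exact ⟨0, by omega, by omega⟩
    · exact ⟨1, by omega, by omega⟩
  obtain ⟨u, _, hu⟩ := hAP j (by omega)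
  obtain ⟨v, _, hv⟩ := hAP (j + 2) (by omega)
  obtain ⟨w, _, hw⟩ := hAP (j + 4) (by omega)
  rw [add_mul] at hv hw
  replace hu := eq_three_pow_add_one_of_even heven hu
  replace hv := eq_three_pow_add_one_of_even (by omega) hv
  replace hw := eq_three_pow_add_one_of_even (by omega) hw
  have hvw : v < w := (Nat.pow_lt_pow_iff_right (a := 3) (by norm_num)).1 (by omega)
  exact three_pow_add_three_pow_ne (u := u) hvw (by omega)
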